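/- Assume the coercivity condition (C) and the monotonicity assumption (M), and let λ > 0. Then there exists a unique viscosity solution v^λ = (v^λ_i)_{i∈𝕀} of (P_λ), and each component v^λ_i is Lipschitz continuous on 𝕋ⁿ. -/

import Mathlib

open MeasureTheory Filter Topology RealInnerProductSpace

noncomputable section

/-- Euclidean space ℝⁿ, the universal cover of the flat torus 𝕋ⁿ = ℝⁿ/ℤⁿ. -/
abbrev Euc (n : ℕ) := EuclideanSpace ℝ (Fin n)

/-- A vector of ℝⁿ with integer coordinates (an element of ℤⁿ). -/
def IsIntVec {n : ℕ} (z : Euc n) : Prop := ∀ i, ∃ k : ℤ, z i = (k : ℝ)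

/-- ℤⁿ-periodic functions on ℝⁿ: these represent functions on the torus 𝕋ⁿ. -/
def TorusFun {n : ℕ} {α : Type*} (f : Euc n → α) : Prop :=
  ∀ (x z : Euc n), IsIntVec z → f (x + z) = f x

/-- Functions on 𝕋ⁿ × Ξ, i.e. ℤⁿ-periodic in the first variable. -/
def TorusFun2 {n : ℕ} {Ξ : Type*} {α : Type*} (f : Euc n × Ξ → α) : Prop :=
  ∀ (x z : Euc n) (ξ : Ξ), IsIntVec z → f (x + z, ξ) = f (x, ξ)

/-- The Hamiltonian H_{φ,i}(x,p) = sup_{ξ∈Ξ} (−g_i(x,ξ)·p − φ_i(x,ξ)). -/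
def ham {n m : ℕ} {Ξ : Type*} (g : Fin m → Euc n × Ξ → Euc n)
    (φ : Fin m → Euc n × Ξ → ℝ) (i : Fin m) (x p : Euc n) : ℝ :=
  ⨆ ξ : Ξ, (-⟪g i (x, ξ), p⟫ - φ i (x, ξ))

/-- The data g = (g_i), L = (L_i) consist of continuous functions on 𝕋ⁿ × Ξ. -/
def GoodData {n m : ℕ} {Ξ : Type*} [TopologicalSpace Ξ]
    (g : Fin m → Euc n × Ξ → Euc n) (L : Fin m → Euc n × Ξ → ℝ) : Prop :=
  (∀ i, Continuous (g i) ∧ TorusFun2 (g i)) ∧ (∀ i, Continuous (L i) ∧ TorusFun2 (L i))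

/-- Coercivity (C): min_{x∈𝕋ⁿ} H_i(x,p) → ∞ as |p| → ∞. -/
def Coercive {n m : ℕ} {Ξ : Type*} (g : Fin m → Euc n × Ξ → Euc n)
    (L : Fin m → Euc n × Ξ → ℝ) : Prop :=
  ∀ (i : Fin m) (M : ℝ), ∃ R : ℝ, ∀ p : Euc n, R ≤ ‖p‖ → ∀ x : Euc n, M ≤ ham g L i x p

/-- A monotone m×m real matrix. -/
def IsMonotoneMat {m : ℕ} (B : Matrix (Fin m) (Fin m) ℝ) : Prop :=
  ∀ (u : Fin m → ℝ) (k : Fin m), (∀ i, u i ≤ u k) → 0 ≤ u k → 0 ≤ ∑ j, B k j * u j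

/-- Assumption (M): B(x) has continuous entries (as functions on 𝕋ⁿ) and is monotone
for every x. -/
def GoodCoupling {n m : ℕ} (B : Euc n → Matrix (Fin m) (Fin m) ℝ) : Prop :=
  (∀ i j, Continuous (fun x => B x i j) ∧ TorusFun (fun x => B x i j)) ∧
    ∀ x, IsMonotoneMat (B x)

/-- Viscosity subsolution of λu + Bu + H_φ[u] = c in 𝕋ⁿ. -/
def IsSubsol {n m : ℕ} {Ξ : Type*} (B : Euc n → Matrix (Fin m) (Fin m) ℝ) (lam : ℝ)
    (g : Fin m → Euc n × Ξ → Euc n) (φ : Fin m → Euc n × Ξ → ℝ)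
    (c : Fin m → ℝ) (u : Fin m → Euc n → ℝ) : Prop :=
  (∀ i, UpperSemicontinuous (u i) ∧ TorusFun (u i)) ∧
    ∀ (i : Fin m) (ψ : Euc n → ℝ), ContDiff ℝ 1 ψ → TorusFun ψ →
      ∀ x : Euc n, IsLocalMax (fun y => u i y - ψ y) x →
        lam * u i x + (∑ j, B x i j * u j x) + ham g φ i x (gradient ψ x) ≤ c i

/-- Viscosity supersolution of λu + Bu + H_φ[u] = c in 𝕋ⁿ. -/
def IsSupersol {n m : ℕ} {Ξ : Type*} (B : Euc n → Matrix (Fin m) (Fin m) ℝ) (lam : ℝ)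
    (g : Fin m → Euc n × Ξ → Euc n) (φ : Fin m → Euc n × Ξ → ℝ)
    (c : Fin m → ℝ) (u : Fin m → Euc n → ℝ) : Prop :=
  (∀ i, LowerSemicontinuous (u i) ∧ TorusFun (u i)) ∧
    ∀ (i : Fin m) (ψ : Euc n → ℝ), ContDiff ℝ 1 ψ → TorusFun ψ →
      ∀ x : Euc n, IsLocalMin (fun y => u i y - ψ y) x →
        c i ≤ lam * u i x + (∑ j, B x i j * u j x) + ham g φ i x (gradient ψ x)

/-- Viscosity solution of λu + Bu + H_φ[u] = c in 𝕋ⁿ. -/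
def IsSol {n m : ℕ} {Ξ : Type*} (B : Euc n → Matrix (Fin m) (Fin m) ℝ) (lam : ℝ)
    (g : Fin m → Euc n × Ξ → Euc n) (φ : Fin m → Euc n × Ξ → ℝ)
    (c : Fin m → ℝ) (u : Fin m → Euc n → ℝ) : Prop :=
  (∀ i, Continuous (u i)) ∧ IsSubsol B lam g φ c u ∧ IsSupersol B lam g φ c u

/-- (φ,u) ∈ F(λ): φ ∈ C(𝕋ⁿ×Ξ)ᵐ, u ∈ C(𝕋ⁿ)ᵐ and u is a viscosity subsolution of
B^λ u + H_φ[u] = 0 in 𝕋ⁿ. -/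
def memF {n m : ℕ} {Ξ : Type*} [TopologicalSpace Ξ]
    (B : Euc n → Matrix (Fin m) (Fin m) ℝ) (lam : ℝ)
    (g : Fin m → Euc n × Ξ → Euc n)
    (φ : Fin m → Euc n × Ξ → ℝ) (u : Fin m → Euc n → ℝ) : Prop :=
  (∀ i, Continuous (φ i) ∧ TorusFun2 (φ i)) ∧ (∀ i, Continuous (u i)) ∧
    IsSubsol B lam g φ (fun _ => 0) u

/-- ρ_i(x) = Σ_j b_{ij}(x). -/
def rhoB {n m : ℕ} (B : Euc n → Matrix (Fin m) (Fin m) ℝ) (i : Fin m) (x : Euc n) : ℝ :=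
  ∑ j, B x i j

/-- ν ∈ P_{B^λ}: a family of finite nonnegative Borel measures with ⟨ν, B^λ1⟩ = 1. -/
def memPB {n m : ℕ} {Ξ : Type*} [MeasurableSpace Ξ]
    (B : Euc n → Matrix (Fin m) (Fin m) ℝ) (lam : ℝ)
    (ν : Fin m → Measure (Euc n × Ξ)) : Prop :=
  (∀ i, IsFiniteMeasure (ν i)) ∧
    (∑ i, ∫ q, (lam + rhoB B i q.1) ∂(ν i)) = 1

/-- ν ∈ G'(z,k,λ): ν ∈ P_{B^λ} and ⟨ν, φ − u_k(z) B^λ1⟩ ≥ 0 for every (φ,u) ∈ F(λ). -/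
def memGP {n m : ℕ} {Ξ : Type*} [TopologicalSpace Ξ] [MeasurableSpace Ξ]
    (B : Euc n → Matrix (Fin m) (Fin m) ℝ) (lam : ℝ)
    (g : Fin m → Euc n × Ξ → Euc n) (z : Euc n) (k : Fin m)
    (ν : Fin m → Measure (Euc n × Ξ)) : Prop :=
  memPB B lam ν ∧
    ∀ φ u, memF B lam g φ u →
      0 ≤ ∑ i, ∫ q, (φ i q - u k z * (lam + rhoB B i q.1)) ∂(ν i)

/-- μ ∈ P: a family of nonnegative Borel measures of total mass 1. -/
def memP {n m : ℕ} {Ξ : Type*} [MeasurableSpace Ξ]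
    (μ : Fin m → Measure (Euc n × Ξ)) : Prop :=
  (∀ i, IsFiniteMeasure (μ i)) ∧ (∑ i, (μ i Set.univ).toReal) = 1

/-- μ ∈ P(z,k,λ): μ ∈ P and Σ_i ⟨μ_i, (λ+ρ_i)⁻¹ φ_i⟩ ≥ u_k(z) for all (φ,u) ∈ F(λ). -/
def memPzk {n m : ℕ} {Ξ : Type*} [TopologicalSpace Ξ] [MeasurableSpace Ξ]
    (B : Euc n → Matrix (Fin m) (Fin m) ℝ) (lam : ℝ)
    (g : Fin m → Euc n × Ξ → Euc n) (z : Euc n) (k : Fin m)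
    (μ : Fin m → Measure (Euc n × Ξ)) : Prop :=
  memP μ ∧
    ∀ φ u, memF B lam g φ u →
      u k z ≤ ∑ i, ∫ q, (lam + rhoB B i q.1)⁻¹ * φ i q ∂(μ i)

/-- μ ∈ P(0): μ ∈ P and ⟨μ,φ⟩ ≥ 0 for all (φ,u) ∈ F(0). -/
def memP0 {n m : ℕ} {Ξ : Type*} [TopologicalSpace Ξ] [MeasurableSpace Ξ]
    (B : Euc n → Matrix (Fin m) (Fin m) ℝ)
    (g : Fin m → Euc n × Ξ → Euc n)
    (μ : Fin m → Measure (Euc n × Ξ)) : Prop :=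
  memP μ ∧ ∀ φ u, memF B 0 g φ u → 0 ≤ ∑ i, ∫ q, φ i q ∂(μ i)

/-- μ ∈ M₊(0): a family of finite nonnegative Borel measures with ⟨μ,φ⟩ ≥ 0 for all
(φ,u) ∈ F(0). -/
def memM0 {n m : ℕ} {Ξ : Type*} [TopologicalSpace Ξ] [MeasurableSpace Ξ]
    (B : Euc n → Matrix (Fin m) (Fin m) ℝ)
    (g : Fin m → Euc n × Ξ → Euc n)
    (μ : Fin m → Measure (Euc n × Ξ)) : Prop :=
  (∀ i, IsFiniteMeasure (μ i)) ∧ ∀ φ u, memF B 0 g φ u → 0 ≤ ∑ i, ∫ q, φ i q ∂(μ i)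

/-- Assumption (E): problem (P₀) has a Lipschitz continuous viscosity solution. -/
def AssumptionE {n m : ℕ} {Ξ : Type*} (B : Euc n → Matrix (Fin m) (Fin m) ℝ)
    (g : Fin m → Euc n × Ξ → Euc n) (L : Fin m → Euc n × Ξ → ℝ) : Prop :=
  ∃ v₀ : Fin m → Euc n → ℝ, (∀ i, ∃ K : NNReal, LipschitzWith K (v₀ i)) ∧
    IsSol B 0 g L (fun _ => 0) v₀

end


section helpers

theorem IsIntVec.neg' {n : ℕ} {z : Euc n} (h : IsIntVec z) : IsIntVec (-z) := by
  intro i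
  obtain ⟨k, hk⟩ := h i
  exact ⟨-k, by simp [hk]⟩

def cubeSet (n : ℕ) : Set (Euc n) := {x | ∀ i, x i ∈ Set.Icc (0:ℝ) 1}

theorem isCompact_cubeSet (n : ℕ) : IsCompact (cubeSet n) := by
  have h : IsCompact (Set.pi Set.univ (fun _ : Fin n => Set.Icc (0:ℝ) 1)) :=
    isCompact_univ_pi (fun _ => isCompact_Icc)
  have h2 := (EuclideanSpace.equiv (Fin n) ℝ).toHomeomorph.isCompact_preimage.2 h
  convert h2 using 1
  ext x
  constructor
  · intro h i _
    exact h i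
  · intro h i
    exact h i trivial

theorem exists_cube {n : ℕ} (x : Euc n) : ∃ z : Euc n, IsIntVec z ∧ x + z ∈ cubeSet n := by
  refine ⟨WithLp.toLp 2 (fun i => -((⌊x i⌋ : ℤ) : ℝ)), fun i => ⟨-⌊x i⌋, by simp⟩, fun i => ?_⟩
  have h1 := Int.floor_le (x i)
  have h2 := Int.lt_floor_add_one (x i)
  simp only [PiLp.add_apply, Set.mem_Icc]
  constructor <;> linarith

theorem cube_nonempty (n : ℕ) : (cubeSet n).Nonempty := by
  obtain ⟨z, _, h⟩ := exists_cube (0 : Euc n)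
  exact ⟨_, h⟩

theorem TorusFun.exists_max {n : ℕ} {f : Euc n → ℝ} (hf : Continuous f) (hp : TorusFun f) :
    ∃ x, ∀ y, f y ≤ f x := by
  obtain ⟨x, _, hx⟩ := (isCompact_cubeSet n).exists_isMaxOn (cube_nonempty n) hf.continuousOn
  refine ⟨x, fun y => ?_⟩
  obtain ⟨z, hz, h⟩ := exists_cube y
  rw [← hp y z hz]
  exact hx h

theorem TorusFun2.unif {n : ℕ} {Ξ E : Type*} [MetricSpace Ξ] [CompactSpace Ξ]
    [SeminormedAddCommGroup E] {f : Euc n × Ξ → E} (hf : Continuous f) (hp : TorusFun2 f)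
    {ε : ℝ} (hε : 0 < ε) :
    ∃ δ > 0, ∀ x y ξ, ‖x - y‖ < δ → ‖f (x, ξ) - f (y, ξ)‖ < ε := by
  obtain ⟨r, hr⟩ := (isCompact_cubeSet n).isBounded.subset_closedBall (0 : Euc n)
  have hK : IsCompact (Metric.closedBall (0 : Euc n) (r+1) ×ˢ (Set.univ : Set Ξ)) :=
    (isCompact_closedBall _ _).prod isCompact_univ
  have hu := hK.uniformContinuousOn_of_continuous hf.continuousOn
  rw [Metric.uniformContinuousOn_iff] at hu
  obtain ⟨δ, hδ, h⟩ := hu ε hε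
  refine ⟨min δ 1, by positivity, fun x y ξ hxy => ?_⟩
  obtain ⟨z, hz, hc⟩ := exists_cube x
  rw [← hp x z ξ hz, ← hp y z ξ hz, ← dist_eq_norm]
  have hx := hr hc
  have h1 : dist (y + z) (x + z) < min δ 1 := by
    rw [dist_add_right, dist_comm, dist_eq_norm]; exact hxy
  apply h
  · refine ⟨Metric.closedBall_subset_closedBall (by linarith) hx, trivial⟩
  · refine ⟨?_, trivial⟩
    have := dist_triangle (y + z) (x + z) 0
    rw [Metric.mem_closedBall] at *
    have := lt_of_lt_of_le h1 (min_le_right _ _)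
    linarith
  · rw [Prod.dist_eq, dist_self, dist_comm]
    exact max_lt (lt_of_lt_of_le h1 (min_le_left _ _)) hδ

theorem TorusFun.unif {n : ℕ} {f : Euc n → ℝ} (hf : Continuous f) (hp : TorusFun f)
    {ε : ℝ} (hε : 0 < ε) :
    ∃ δ > 0, ∀ x y, ‖x - y‖ < δ → ‖f x - f y‖ < ε := by
  obtain ⟨δ, hδ, h⟩ := TorusFun2.unif (f := fun q : Euc n × Unit => f q.1)
    (hf.comp continuous_fst) (fun x z _ hz => hp x z hz) hε
  exact ⟨δ, hδ, fun x y => h x y ()⟩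

theorem TorusFun.bdd {n : ℕ} {f : Euc n → ℝ} (hf : Continuous f) (hp : TorusFun f) :
    ∃ C, 0 ≤ C ∧ ∀ x, |f x| ≤ C := by
  obtain ⟨x, hx⟩ := TorusFun.exists_max (f := fun x => |f x|) hf.abs
    (fun x z hz => by simp only [hp x z hz])
  exact ⟨|f x|, abs_nonneg _, hx⟩

theorem continuous_ham {n m : ℕ} {Ξ : Type*} [MetricSpace Ξ] [CompactSpace Ξ]
    {g : Fin m → Euc n × Ξ → Euc n} {L : Fin m → Euc n × Ξ → ℝ}
    (h : GoodData g L) (i : Fin m) : Continuous (fun q : Euc n × Euc n => ham g L i q.1 q.2) := by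
  have hg := (h.1 i).1
  have hL := (h.2 i).1
  have := IsCompact.continuous_sSup (K := (Set.univ : Set Ξ))
    (f := fun (q : Euc n × Euc n) ξ => (-⟪g i (q.1, ξ), q.2⟫ - L i (q.1, ξ))) isCompact_univ
    (by simp only [Function.HasUncurry.uncurry, id]; fun_prop)
  simpa only [ham, Set.image_univ, iSup] using this

theorem ham_periodic {n m : ℕ} {Ξ : Type*} [MetricSpace Ξ] [CompactSpace Ξ]
    {g : Fin m → Euc n × Ξ → Euc n} {L : Fin m → Euc n × Ξ → ℝ}
    (h : GoodData g L) (i : Fin m) (x z p : Euc n) (hz : IsIntVec z) :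
    ham g L i (x + z) p = ham g L i x p := by
  unfold ham
  simp only [(h.1 i).2 x z _ hz, (h.2 i).2 x z _ hz]

theorem mono_off {m : ℕ} {B : Matrix (Fin m) (Fin m) ℝ} (h : IsMonotoneMat B) {i j : Fin m}
    (hij : j ≠ i) : B i j ≤ 0 := by
  have := h (fun k => if k = j then -1 else 0) i (fun k => by
    simp only [hij.symm, if_false]; split_ifs <;> norm_num) (by simp [hij.symm])
  simpa using this

theorem mono_diag {m : ℕ} {B : Matrix (Fin m) (Fin m) ℝ} (h : IsMonotoneMat B) (i : Fin m) :
    0 ≤ B i i := by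
  have := h (fun k => if k = i then 1 else 0) i (fun k => by
    simp only [if_true]; split_ifs <;> norm_num) (by simp)
  simpa using this

theorem mono_row {m : ℕ} {B : Matrix (Fin m) (Fin m) ℝ} (h : IsMonotoneMat B) (i : Fin m) :
    0 ≤ ∑ j, B i j := by
  have := h (fun k => 1) i (fun k => le_rfl) (by simp)
  simpa using this

theorem grad_periodic {n : ℕ} {f : Euc n → ℝ} (hp : TorusFun f) : TorusFun (gradient f) := by
  intro x z hz
  unfold gradient
  have : (fun y => f (y + z)) = f := funext fun y => hp y z hz
  rw [← fderiv_comp_add_right, this]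

theorem grad_continuous {n : ℕ} {f : Euc n → ℝ} (hf : ContDiff ℝ 1 f) :
    Continuous (gradient f) := by
  unfold gradient
  exact (LinearIsometryEquiv.continuous _).comp (hf.continuous_fderiv (by norm_num))

/-- gradient of separable functions -/
theorem hasGradient_sep {n : ℕ} (f : Fin n → ℝ → ℝ) (x p : Euc n)
    (h : ∀ k, HasDerivAt (f k) (p k) (x k)) :
    HasGradientAt (fun y : Euc n => ∑ k, f k (y k)) p x := by
  rw [hasGradientAt_iff_hasFDerivAt]
  have h1 : ∀ k ∈ (Finset.univ : Finset (Fin n)), HasFDerivAt (fun y : Euc n => f k (y k))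
      ((p k) • (EuclideanSpace.proj k : Euc n →L[ℝ] ℝ)) x := fun k _ => by
    have := (h k).comp_hasFDerivAt x (EuclideanSpace.proj k : Euc n →L[ℝ] ℝ).hasFDerivAt
    exact this
  have h2 := HasFDerivAt.fun_sum h1
  have h3 : (InnerProductSpace.toDual ℝ (Euc n)) p =
      ∑ k, (p k) • (EuclideanSpace.proj k : Euc n →L[ℝ] ℝ) := by
    ext y
    simp [PiLp.inner_apply, mul_comm, InnerProductSpace.toDual_apply_apply]
  rw [h3]
  exact h2

/-- periodic squared distance -/
noncomputable def perS {n : ℕ} (y : Euc n) : ℝ := ∑ k, Real.sin (Real.pi * y k) ^ 2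

theorem perS_contDiff {n : ℕ} : ContDiff ℝ 1 (perS (n := n)) := by
  unfold perS
  fun_prop

theorem perS_nonneg {n : ℕ} (y : Euc n) : 0 ≤ perS y := Finset.sum_nonneg fun _ _ => sq_nonneg _

theorem sin_sq_int (t : ℝ) (k : ℤ) :
    Real.sin (Real.pi * (t + k)) ^ 2 = Real.sin (Real.pi * t) ^ 2 := by
  have : Real.pi * (t + k) = Real.pi * t + k * Real.pi := by ring
  rw [this, Real.sin_add_int_mul_pi, mul_pow, ← zpow_natCast, ← zpow_mul]
  simp [mul_comm k 2, zpow_mul]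

theorem perS_periodic {n : ℕ} : TorusFun (perS (n := n)) := by
  intro x z hz
  unfold perS
  refine Finset.sum_congr rfl fun k _ => ?_
  obtain ⟨a, ha⟩ := hz k
  rw [PiLp.add_apply, ha, sin_sq_int]

theorem sin_sq_ge (t : ℝ) (ht : |t| ≤ 1/2) : 4 * t^2 ≤ Real.sin (Real.pi * t)^2 := by
  have hp := Real.pi_pos
  have h := Real.mul_le_sin (x := Real.pi * |t|) (by positivity) (by nlinarith)
  have h2 : 2 / Real.pi * (Real.pi * |t|) = 2 * |t| := by field_simp
  rw [h2] at h
  have h3 : Real.sin (Real.pi * t)^2 = Real.sin (Real.pi * |t|)^2 := by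
    rcases abs_cases t with ⟨h, _⟩ | ⟨h, _⟩ <;> rw [h]
    rw [mul_neg, Real.sin_neg, neg_sq]
  rw [h3, ← sq_abs t]
  nlinarith [abs_nonneg t]

theorem perS_ge {n : ℕ} (y : Euc n) : ∃ z : Euc n, IsIntVec z ∧ 4 * ‖y - z‖^2 ≤ perS y := by
  refine ⟨WithLp.toLp 2 (fun k => ((round (y k) : ℤ) : ℝ)), fun k => ⟨round (y k), rfl⟩, ?_⟩
  rw [EuclideanSpace.real_norm_sq_eq, Finset.mul_sum]
  refine Finset.sum_le_sum fun k _ => ?_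
  simp only [PiLp.sub_apply]
  refine (sin_sq_ge _ (abs_sub_round _)).trans_eq ?_
  have := sin_sq_int (y k - round (y k)) (round (y k))
  rw [sub_add_cancel] at this
  exact this.symm

theorem perS_zero {n : ℕ} : perS (0 : Euc n) = 0 := by simp [perS]

theorem perS_neg {n : ℕ} (y : Euc n) : perS (-y) = perS y := by simp [perS]

theorem grad_add_perS {n : ℕ} {ψ : Euc n → ℝ} (hψ : ContDiff ℝ 1 ψ) (x : Euc n) (a C : ℝ) :
    gradient (fun y => ψ y + a + C * perS (y - x)) x = gradient ψ x := by
  have hd : DifferentiableAt ℝ ψ x := hψ.differentiable (by norm_num) x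
  have h1 : HasGradientAt (fun y : Euc n => ∑ k, C * Real.sin (Real.pi * (y k - x k)) ^ 2) 0 x := by
    apply hasGradient_sep (fun k t => C * Real.sin (Real.pi * (t - x k)) ^ 2)
    intro k
    have := ((((hasDerivAt_id (x k)).sub_const (x k)).const_mul Real.pi).sin.pow 2).const_mul C
    exact this.congr_deriv (by simp)
  have h2 : (fun y => ψ y + a + C * perS (y - x)) =
      fun y => (ψ y + a) + ∑ k, C * Real.sin (Real.pi * (y k - x k)) ^ 2 := by
    funext y
    simp [perS, Finset.mul_sum]
  rw [hasGradientAt_iff_hasFDerivAt, map_zero] at h1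
  rw [h2]
  unfold gradient
  have := (hd.hasFDerivAt.add_const a).add h1
  rw [add_zero] at this
  congr 1
  exact this.fderiv

/-- globalization of test functions -/
theorem globalize {n : ℕ} {f ψ : Euc n → ℝ} (hf : Continuous f) (hfp : TorusFun f)
    (hψ : ContDiff ℝ 1 ψ) (hψp : TorusFun ψ) {x : Euc n}
    (hx : IsLocalMax (fun y => f y - ψ y) x) :
    ∃ φ : Euc n → ℝ, ContDiff ℝ 1 φ ∧ TorusFun φ ∧ φ x = f x ∧ gradient φ x = gradient ψ x ∧
      ∀ y, f y + perS (y - x) ≤ φ y := by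
  obtain ⟨D, hD0, hD⟩ := TorusFun.bdd (f := fun y => f y - ψ y) (hf.sub hψ.continuous)
    (fun x z hz => by simp only [hfp x z hz, hψp x z hz])
  obtain ⟨r, hr, hball⟩ := Metric.eventually_nhds_iff.1 hx
  set C : ℝ := 2 * D / (4 * r^2) + 1 with hC
  have hC1 : 1 ≤ C := by
    have : 0 ≤ 2 * D / (4 * r^2) := by positivity
    linarith
  refine ⟨fun y => ψ y + (f x - ψ x) + C * perS (y - x), ?_, ?_, ?_, ?_, ?_⟩
  · have := perS_contDiff (n := n)
    fun_prop
  · intro y z hz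
    simp only
    rw [hψp y z hz, show y + z - x = y - x + z by abel, perS_periodic _ z hz]
  · simp [perS_zero]
  · exact grad_add_perS hψ x _ _
  · intro y
    simp only
    obtain ⟨z, hz, h4⟩ := perS_ge (y - x)
    have h0 := perS_nonneg (y - x)
    by_cases hy : ‖y - x - z‖ < r
    · have := hball (y := y - z) (by rw [dist_eq_norm, show y - z - x = y - x - z by abel]; exact hy)
      have e1 := hfp y _ hz.neg'
      have e2 := hψp y _ hz.neg'
      rw [← sub_eq_add_neg] at e1 e2
      simp only [e1, e2] at this
      nlinarith
    · push Not at hy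
      have h5 : 4 * r^2 ≤ perS (y - x) := by nlinarith
      have h6 : C * perS (y - x) ≥ 2 * D + perS (y - x) := by
        rw [hC, add_mul, one_mul]
        have : 2 * D / (4 * r^2) * (4 * r^2) = 2 * D := by field_simp
        have h7 : 2 * D / (4 * r^2) * (4 * r^2) ≤ 2 * D / (4 * r^2) * perS (y - x) := by gcongr
        linarith
      have a1 := abs_le.1 (hD x)
      have a2 := abs_le.1 (hD y)
      linarith [a1.1, a2.2]

theorem sin_aux {s : ℝ} (hs : |s| ≤ 1) : |Real.sin s - s| ≤ s^2 := by
  have h := Real.sin_bound hs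
  have h0 := abs_nonneg s
  have e4 : |s|^4 ≤ s^2 := by
    rw [← sq_abs s]; nlinarith [pow_le_one₀ h0 hs (n := 2), sq_nonneg |s|]
  have e3 : |s^3/6| ≤ s^2/6 := by
    rw [abs_div, abs_pow, ← sq_abs s, abs_of_pos (by norm_num : (0:ℝ) < 6)]
    nlinarith [sq_nonneg |s|]
  have : Real.sin s - s = (Real.sin s - (s - s^3/6)) + -(s^3/6) := by ring
  rw [this]
  refine (abs_add_le _ _).trans ?_
  rw [abs_neg]
  nlinarith

/-- one-dimensional periodic majorant -/
theorem onedim {p c P t : ℝ} (hc : 0 ≤ c) (hP : |p| ≤ P) (ht : |t| ≤ 1/8) :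
    p * t + c * t^2 ≤ p * (Real.sin (2 * Real.pi * t) / (2 * Real.pi))
      + (c + 2 * P) * Real.sin (Real.pi * t)^2 := by
  have hpi := Real.pi_pos
  have hpi4 := Real.pi_lt_four
  have h1 := sin_sq_ge t (by linarith)
  have h2 := sin_aux (s := 2 * Real.pi * t) (by
    rw [abs_mul, abs_of_pos (by positivity : 0 < 2 * Real.pi)]
    nlinarith [abs_nonneg t])
  have hP0 := (abs_nonneg p).trans hP
  have h3 : |Real.sin (2 * Real.pi * t) / (2 * Real.pi) - t| ≤ 8 * t^2 := by
    have : Real.sin (2 * Real.pi * t) / (2 * Real.pi) - t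
      = (Real.sin (2 * Real.pi * t) - 2 * Real.pi * t) / (2 * Real.pi) := by field_simp
    rw [this, abs_div, abs_of_pos (by positivity : 0 < 2 * Real.pi), div_le_iff₀ (by positivity)]
    refine h2.trans ?_
    have e : (2 * Real.pi * t)^2 = (2 * Real.pi * t^2) * (2 * Real.pi) := by ring
    rw [e]
    have : 2 * Real.pi * t^2 ≤ 8 * t^2 := by nlinarith [sq_nonneg t]
    gcongr
  have h4 : |p * (Real.sin (2 * Real.pi * t) / (2 * Real.pi) - t)| ≤ P * (8 * t^2) := by
    rw [abs_mul]; gcongr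
  have h5 := (abs_le.1 h4).1
  have h6 : (c + 2 * P) * (4 * t^2) ≤ (c + 2 * P) * Real.sin (Real.pi * t)^2 := by gcongr
  nlinarith [mul_nonneg hc (sq_nonneg t)]

theorem sub_quadratic {n m : ℕ} {Ξ : Type*} {B : Euc n → Matrix (Fin m) (Fin m) ℝ} {lam : ℝ}
    {g : Fin m → Euc n × Ξ → Euc n} {L : Fin m → Euc n × Ξ → ℝ} {u : Fin m → Euc n → ℝ}
    (hu : IsSubsol B lam g L (fun _ => 0) u) (i : Fin m) (x p : Euc n) (c : ℝ) (hc : 0 ≤ c)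
    (h : ∀ y, u i y ≤ u i x + ⟪p, y - x⟫ + c * ‖y - x‖^2) :
    lam * u i x + (∑ j, B x i j * u j x) + ham g L i x p ≤ 0 := by
  have hpi := Real.pi_pos
  let f : Fin n → ℝ → ℝ := fun k t => p k * (Real.sin (2 * Real.pi * (t - x k)) / (2 * Real.pi))
      + (c + 2 * ‖p‖) * Real.sin (Real.pi * (t - x k))^2
  have hgr : HasGradientAt (fun y : Euc n => ∑ k, f k (y k)) p x := by
    apply hasGradient_sep
    intro k
    have h1 := ((((hasDerivAt_id (x k)).sub_const (x k)).const_mul Real.pi).sin.pow 2).const_mul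
      (c + 2 * ‖p‖)
    have h2 := ((((hasDerivAt_id (x k)).sub_const (x k)).const_mul
      (2 * Real.pi)).sin.div_const (2 * Real.pi)).const_mul (p k)
    refine (h2.add h1).congr_deriv ?_
    simp
    try field_simp
  have := hu.2 i (fun y : Euc n => ∑ k, f k (y k)) (by simp only [f]; fun_prop) ?_ x ?_
  · rwa [hgr.gradient] at this
  · intro y z hz
    refine Finset.sum_congr rfl fun k _ => ?_
    obtain ⟨a, ha⟩ := hz k
    simp only [f]
    rw [PiLp.add_apply, ha, show y k + a - x k = y k - x k + a by ring, sin_sq_int,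
      show 2 * Real.pi * (y k - x k + a) = 2 * Real.pi * (y k - x k) + a * (2 * Real.pi) by ring,
      Real.sin_add_int_mul_two_pi]
  · have hfx : ∑ k, f k (x k) = 0 := by simp [f]
    filter_upwards [Metric.ball_mem_nhds x (by norm_num : (0:ℝ) < 1/8)] with y hy
    rw [hfx]
    have h1 := h y
    rw [Metric.mem_ball, dist_eq_norm] at hy
    have h2 : ⟪p, y - x⟫ + c * ‖y - x‖^2 = ∑ k, (p k * (y k - x k) + c * (y k - x k)^2) := by
      rw [EuclideanSpace.real_norm_sq_eq, Finset.mul_sum, Finset.sum_add_distrib]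
      simp [PiLp.inner_apply, mul_comm]
    have h3 : ∑ k, (p k * (y k - x k) + c * (y k - x k)^2) ≤ ∑ k, f k (y k) := by
      refine Finset.sum_le_sum fun k _ => ?_
      apply onedim hc
      · exact PiLp.norm_apply_le p k
      · exact (PiLp.norm_apply_le (y - x) k).trans hy.le
    linarith

theorem Bbound {n m : ℕ} {B : Euc n → Matrix (Fin m) (Fin m) ℝ} (hB : GoodCoupling B) :
    ∃ b, 0 ≤ b ∧ ∀ x i j, |B x i j| ≤ b := by
  have := fun q : Fin m × Fin m => TorusFun.bdd (hB.1 q.1 q.2).1 (hB.1 q.1 q.2).2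
  choose b hb0 hb using this
  refine ⟨∑ q, b q, Finset.sum_nonneg fun q _ => hb0 q, fun x i j => (hb (i, j) x).trans ?_⟩
  exact Finset.single_le_sum (f := b) (fun q _ => hb0 q) (Finset.mem_univ (i, j))

/-- uniform bound on gradients -/
theorem grad_bound {n m : ℕ} {Ξ : Type*} 
    {g : Fin m → Euc n × Ξ → Euc n} {L : Fin m → Euc n × Ξ → ℝ}
    (hcoer : Coercive g L)
    {B : Euc n → Matrix (Fin m) (Fin m) ℝ} (hB : GoodCoupling B) (lam C : ℝ) (hC : 0 ≤ C) :
    ∃ R, 0 ≤ R ∧ ∀ (u : Fin m → ℝ) (i : Fin m) (x p : Euc n), (∀ j, |u j| ≤ C) →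
      lam * u i + (∑ j, B x i j * u j) + ham g L i x p ≤ 0 → ‖p‖ ≤ R := by
  obtain ⟨b, hb0, hb⟩ := Bbound hB
  choose R hR using fun i => hcoer i (|lam| * C + ∑ _j : Fin m, b * C + 1)
  refine ⟨∑ i, |R i|, Finset.sum_nonneg fun _ _ => abs_nonneg _, fun u i x p hu h => ?_⟩
  by_contra hlt
  push Not at hlt
  have h1 : R i ≤ ‖p‖ := (le_abs_self _).trans ((Finset.single_le_sum (f := fun i => |R i|)
    (fun q _ => abs_nonneg _) (Finset.mem_univ i)).trans hlt.le)
  have h2 := hR i p h1 x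
  have h3 : |lam * u i| ≤ |lam| * C := by
    rw [abs_mul]; exact mul_le_mul_of_nonneg_left (hu i) (abs_nonneg _)
  have h4 : |∑ j, B x i j * u j| ≤ ∑ _j : Fin m, b * C := by
    refine (Finset.abs_sum_le_sum_abs _ _).trans (Finset.sum_le_sum fun j _ => ?_)
    rw [abs_mul]
    exact mul_le_mul (hb x i j) (hu j) (abs_nonneg _) hb0
  linarith [(abs_le.1 h3).1, (abs_le.1 h4).1]

theorem norm_quad {n : ℕ} (a h : Euc n) (ha : a ≠ 0) :
    ‖a + h‖ ≤ ‖a‖ + ⟪a, h⟫ / ‖a‖ + ‖h‖^2 / (2 * ‖a‖) := by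
  have hp : 0 < ‖a‖ := norm_pos_iff.2 ha
  have h1 := norm_add_sq_real a h
  have : ‖a‖ + ⟪a, h⟫ / ‖a‖ + ‖h‖^2 / (2 * ‖a‖) = (‖a + h‖^2 + ‖a‖^2) / (2 * ‖a‖) := by
    rw [h1]; field_simp; ring
  rw [this, le_div_iff₀ (by positivity)]
  nlinarith [sq_nonneg (‖a + h‖ - ‖a‖)]

theorem sub_lipschitz {n m : ℕ} {Ξ : Type*} {B : Euc n → Matrix (Fin m) (Fin m) ℝ} {lam : ℝ}
    {g : Fin m → Euc n × Ξ → Euc n} {L : Fin m → Euc n × Ξ → ℝ} {u : Fin m → Euc n → ℝ}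
    (hcont : ∀ i, Continuous (u i))
    (hu : IsSubsol B lam g L (fun _ => 0) u) (C R : ℝ) (hR0 : 0 ≤ R) (hC : ∀ j x, |u j x| ≤ C)
    (hR : ∀ (u : Fin m → ℝ) (i : Fin m) (x p : Euc n), (∀ j, |u j| ≤ C) →
      lam * u i + (∑ j, B x i j * u j) + ham g L i x p ≤ 0 → ‖p‖ ≤ R) (i : Fin m) :
    LipschitzWith (Real.toNNReal (R+1)) (u i) := by
  apply LipschitzWith.of_le_add_mul
  intro x' y
  rw [Real.coe_toNNReal _ (by linarith)]
  set K := R + 1 with hK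
  have hKpos : 0 < K := by linarith
  -- maximum
  have hC0 : 0 ≤ C := (abs_nonneg _).trans (hC i y)
  obtain ⟨x, hx⟩ : ∃ x, ∀ w, u i w - K * ‖w - y‖ ≤ u i x - K * ‖x - y‖ := by
    have hc : Continuous (fun w => u i w - K * ‖w - y‖) := by
      have := hcont i
      fun_prop
    obtain ⟨x, hxm, hx⟩ := (isCompact_closedBall y (2 * C / K)).exists_isMaxOn
      ⟨y, Metric.mem_closedBall_self (by positivity)⟩ hc.continuousOn
    refine ⟨x, fun w => ?_⟩
    by_cases hw : w ∈ Metric.closedBall y (2 * C / K)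
    · exact hx hw
    · have h1 := hx (Metric.mem_closedBall_self (x := y) (by positivity : 0 ≤ 2 * C / K))
      rw [Metric.mem_closedBall, dist_eq_norm, not_le, div_lt_iff₀ hKpos] at hw
      simp only [Set.mem_ofPred_eq, sub_self, norm_zero, mul_zero, sub_zero] at h1
      have := abs_le.1 (hC i w)
      have := abs_le.1 (hC i y)
      linarith
  have hxy : x = y := by
    by_contra hne
    have ha : x - y ≠ 0 := sub_ne_zero.2 hne
    have hp : 0 < ‖x - y‖ := norm_pos_iff.2 ha
    have h1 := sub_quadratic hu i x ((K / ‖x - y‖) • (x - y)) (K / (2 * ‖x - y‖)) (by positivity)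
      (fun w => by
        have h2 := hx w
        have h3 := norm_quad (x - y) (w - x) ha
        rw [show x - y + (w - x) = w - y by abel] at h3
        have h4 := mul_le_mul_of_nonneg_left h3 hKpos.le
        rw [real_inner_smul_left]
        have e : K * (‖x - y‖ + ⟪x - y, w - x⟫ / ‖x - y‖ + ‖w - x‖^2 / (2 * ‖x - y‖))
          = K * ‖x - y‖ + K / ‖x - y‖ * ⟪x - y, w - x⟫
            + K / (2 * ‖x - y‖) * ‖w - x‖^2 := by ring
        linarith)
    have h2 := hR (fun j => u j x) i x _ (fun j => hC j x) h1
    rw [norm_smul, Real.norm_of_nonneg (by positivity), div_mul_cancel₀ _ hp.ne'] at h2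
    linarith
  have := hx x'
  rw [hxy] at this
  simp only [sub_self, norm_zero, mul_zero, sub_zero] at this
  rw [dist_eq_norm]
  linarith

theorem grad_perS_shift {n : ℕ} (α : ℝ) (x y : Euc n) :
    ∃ p, gradient (fun w => α * perS (w - y)) x = p ∧
      gradient (fun w => -(α * perS (x - w))) y = p := by
  let p : Euc n := WithLp.toLp 2 (fun k => α * (2 * Real.sin (Real.pi * (x k - y k)) *
    (Real.cos (Real.pi * (x k - y k)) * Real.pi)))
  refine ⟨p, ?_, ?_⟩
  · have : HasGradientAt (fun w : Euc n => ∑ k, (fun k t => α *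
        Real.sin (Real.pi * (t - y k)) ^ 2) k (w k)) p x := by
      apply hasGradient_sep (fun k t => α * Real.sin (Real.pi * (t - y k)) ^ 2)
      intro k
      have := ((((hasDerivAt_id (x k)).sub_const (y k)).const_mul Real.pi).sin.pow 2).const_mul α
      exact this.congr_deriv (by simp [p])
    rw [← this.gradient]
    congr 1
    funext w
    simp [perS, Finset.mul_sum]
  · have : HasGradientAt (fun w : Euc n => ∑ k, (fun k t => -(α *
        Real.sin (Real.pi * (x k - t)) ^ 2)) k (w k)) p y := by
      apply hasGradient_sep (fun k t => -(α * Real.sin (Real.pi * (x k - t)) ^ 2))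
      intro k
      have := (((((hasDerivAt_id (y k)).const_sub (x k)).const_mul Real.pi).sin.pow 2).const_mul
        α).neg
      exact this.congr_deriv (by simp [p])
    rw [← this.gradient]
    congr 1
    funext w
    simp [perS, Finset.mul_sum]

theorem unif_aux {n m : ℕ} {Ξ : Type*} [MetricSpace Ξ] [CompactSpace Ξ]
    {g : Fin m → Euc n × Ξ → Euc n} {L : Fin m → Euc n × Ξ → ℝ}
    (hgL : GoodData g L)
    {B : Euc n → Matrix (Fin m) (Fin m) ℝ} (hB : GoodCoupling B) (i : Fin m) (R V : ℝ)
    {ε : ℝ} (hε : 0 < ε) : ∃ δ > 0, ∀ x y (ξ : Metric.closedBall (0 : Euc n) R ×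
      Metric.closedBall (0 : Fin m → ℝ) V), ‖x - y‖ < δ →
      ‖((∑ j, B x i j * ξ.2.1 j) + ham g L i x ξ.1.1) -
        ((∑ j, B y i j * ξ.2.1 j) + ham g L i y ξ.1.1)‖ < ε := by
  have : CompactSpace (Metric.closedBall (0 : Euc n) R) :=
    isCompact_iff_compactSpace.1 (isCompact_closedBall _ _)
  have : CompactSpace (Metric.closedBall (0 : Fin m → ℝ) V) :=
    isCompact_iff_compactSpace.1 (isCompact_closedBall _ _)
  refine TorusFun2.unif (f := fun q : Euc n × (Metric.closedBall (0 : Euc n) R ×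
    Metric.closedBall (0 : Fin m → ℝ) V) =>
    ((∑ j, B q.1 i j * q.2.2.1 j) + ham g L i q.1 q.2.1.1)) ?_ ?_ hε
  · refine Continuous.add (continuous_finsetSum _ fun j _ => ?_) ?_
    · exact ((hB.1 i j).1.comp continuous_fst).mul ((continuous_apply j).comp
        (continuous_subtype_val.comp (continuous_snd.comp continuous_snd)))
    · exact Continuous.comp (g := fun q : Euc n × Euc n => ham g L i q.1 q.2)
        (f := fun q : Euc n × (Metric.closedBall (0 : Euc n) R ×
          Metric.closedBall (0 : Fin m → ℝ) V) => (q.1, q.2.1.1)) (continuous_ham hgL i)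
        (by fun_prop)
  · intro x z ξ hz
    simp only [ham_periodic hgL i x z _ hz]
    congr 1
    exact Finset.sum_congr rfl fun j _ => by
      have := (hB.1 i j).2 x z hz
      simp only at this
      rw [this]

theorem comparison {n m : ℕ} {Ξ : Type*} [MetricSpace Ξ] [CompactSpace Ξ]
    {g : Fin m → Euc n × Ξ → Euc n} {L : Fin m → Euc n × Ξ → ℝ}
    (hgL : GoodData g L)
    {B : Euc n → Matrix (Fin m) (Fin m) ℝ} (hB : GoodCoupling B)
    {lam : ℝ} (hlam : 0 < lam) {u v : Fin m → Euc n → ℝ} (huc : ∀ i, Continuous (u i))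
    (hvc : ∀ i, Continuous (v i)) (hu : IsSubsol B lam g L (fun _ => 0) u)
    (hv : IsSupersol B lam g L (fun _ => 0) v) (K : NNReal) (hK : ∀ i, LipschitzWith K (u i))
    (C R : ℝ) (hC : ∀ j x, |u j x| ≤ C)
    (hR : ∀ (u : Fin m → ℝ) (i : Fin m) (x p : Euc n), (∀ j, |u j| ≤ C) →
      lam * u i + (∑ j, B x i j * u j) + ham g L i x p ≤ 0 → ‖p‖ ≤ R) (i : Fin m) (x : Euc n) :
    u i x ≤ v i x := by
  by_contra hlt
  push Not at hlt
  set θ := u i x - v i x with hθ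
  have hθ0 : 0 < θ := sub_pos.2 hlt
  -- bound on v
  obtain ⟨V, hV⟩ : ∃ V, ∀ y, ‖(fun j => v j y)‖ ≤ V := by
    obtain ⟨V, _, hV⟩ := TorusFun.bdd (f := fun y => ‖(fun j => v j y)‖)
      (by fun_prop) (fun y z hz => by
        have : (fun j => v j (y + z)) = fun j => v j y := funext fun j => (hv.1 j).2 y z hz
        simp only [this])
    exact ⟨V, fun y => (le_abs_self _).trans (hV y)⟩
  have hun : ∀ i, ∃ δ > 0, ∀ x y (ξ : Metric.closedBall (0 : Euc n) R ×
      Metric.closedBall (0 : Fin m → ℝ) V), ‖x - y‖ < δ →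
      ‖((∑ j, B x i j * ξ.2.1 j) + ham g L i x ξ.1.1) -
        ((∑ j, B y i j * ξ.2.1 j) + ham g L i y ξ.1.1)‖ < lam * θ := fun i => by
    exact unif_aux hgL hB i R V (by positivity)
  choose δ hδ0 hδ using hun
  have : Nonempty (Fin m) := ⟨i⟩
  obtain ⟨i1, hi1⟩ := Finite.exists_min δ
  set d := δ i1 with hd
  have hd0 : 0 < d := hδ0 i1
  set α : ℝ := (K + 1) / d with hα
  have hα0 : 0 < α := by positivity
  have hScont : Continuous (perS (n := n)) := perS_contDiff.continuous
  -- doubling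
  have hmax : ∀ i, ∃ q : Euc n × Euc n, ∀ y w, u i y - v i w - α * perS (y - w) ≤
      u i q.1 - v i q.2 - α * perS (q.1 - q.2) := fun i => by
    have hcont : Continuous (fun q : Euc n × Euc n => u i q.1 - v i q.2 - α * perS (q.1 - q.2)) := by
      have := huc i
      have := hvc i
      fun_prop
    obtain ⟨q, _, hq⟩ := ((isCompact_cubeSet n).prod (isCompact_cubeSet n)).exists_isMaxOn
      ((cube_nonempty n).prod (cube_nonempty n)) hcont.continuousOn
    refine ⟨q, fun y w => ?_⟩
    obtain ⟨z, hz, h1⟩ := exists_cube y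
    obtain ⟨z', hz', h2⟩ := exists_cube w
    have h3 := hq (show (y + z, w + z') ∈ _ from ⟨h1, h2⟩)
    simp only [Set.mem_ofPred_eq] at h3
    rw [(hu.1 i).2 y z hz, (hv.1 i).2 w z' hz', show y + z - (w + z') = y - w + z + (-z') by abel,
      perS_periodic _ _ hz'.neg', perS_periodic _ _ hz] at h3
    exact h3
  choose q hq using hmax
  obtain ⟨k, hk⟩ := Finite.exists_max (fun i => u i (q i).1 - v i (q i).2 -
    α * perS ((q i).1 - (q i).2))
  obtain ⟨a, b, hab, hmax⟩ : ∃ a b : Euc n, 4 * ‖a - b‖^2 ≤ perS (a - b) ∧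
      ∀ i y w, u i y - v i w - α * perS (y - w) ≤ u k a - v k b - α * perS (a - b) := by
    obtain ⟨z, hz, h4⟩ := perS_ge ((q k).1 - (q k).2)
    have e : perS ((q k).1 - ((q k).2 + z)) = perS ((q k).1 - (q k).2) := by
      rw [show (q k).1 - ((q k).2 + z) = (q k).1 - (q k).2 + (-z) by abel,
        perS_periodic _ _ hz.neg']
    refine ⟨(q k).1, (q k).2 + z, ?_, fun i y w => ?_⟩
    · rw [e, ← sub_sub]; exact h4
    · rw [e, (hv.1 k).2 _ z hz]
      exact (hq i y w).trans (hk i)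
  have hS0 := perS_nonneg (a - b)
  have hbig : θ ≤ u k a - v k b := by
    have := hmax i x x
    rw [sub_self, perS_zero] at this
    nlinarith
  have hclose : ‖a - b‖ < d := by
    have h1 := hmax k b b
    rw [sub_self, perS_zero] at h1
    have h2 := (abs_le.1 ((Real.dist_eq _ _) ▸ (hK k).dist_le_mul a b)).2
    rw [dist_eq_norm] at h2
    by_contra hge
    push Not at hge
    have h3 : α * (4 * ‖a - b‖^2) ≤ K * ‖a - b‖ := by nlinarith
    have h4 : α * d = K + 1 := by rw [hα]; field_simp
    have h5 : (K + 1) * ‖a - b‖ ≤ α * ‖a - b‖ ^ 2 := by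
      rw [← h4, pow_two, ← mul_assoc]; gcongr
    have h6 : 0 < ‖a - b‖ := lt_of_lt_of_le hd0 hge
    nlinarith [K.2]
  obtain ⟨p, hp1, hp2⟩ := grad_perS_shift α a b
  have hsub := hu.2 k (fun w => α * perS (w - b)) (by have := perS_contDiff (n := n); fun_prop)
    (fun w z hz => by
      simp only
      rw [show w + z - b = w - b + z by abel, perS_periodic _ _ hz]) a
    (Filter.Eventually.of_forall fun y => by have := hmax k y b; simp only; linarith)
  have hsup := hv.2 k (fun w => -(α * perS (a - w))) (by have := perS_contDiff (n := n); fun_prop)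
    (fun w z hz => by
      simp only
      rw [show a - (w + z) = a - w + -z by abel, perS_periodic _ _ hz.neg']) b
    (Filter.Eventually.of_forall fun y => by have := hmax k a y; simp only; linarith)
  rw [hp1] at hsub
  rw [hp2] at hsup
  have hpR : ‖p‖ ≤ R := hR (fun j => u j a) k a p (fun j => hC j a) hsub
  have hfin := hδ k a b (⟨p, by simpa using hpR⟩, ⟨fun j => v j b, by simpa using hV b⟩)
    (lt_of_lt_of_le hclose (hi1 k))
  have hfin2 := (abs_lt.1 hfin).1
  simp only at hfin2
  have hmono := hB.2 a (fun j => u j a - v j b) k (fun j => by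
    have := hmax j a b; linarith) (by linarith)
  simp only [mul_sub, Finset.sum_sub_distrib] at hmono
  have : lam * θ ≤ lam * (u k a - v k b) := by gcongr
  linarith

/-- the operator with frozen coupling -/
noncomputable def opF {n m : ℕ} {Ξ : Type*} (B : Euc n → Matrix (Fin m) (Fin m) ℝ) (lam : ℝ)
    (g : Fin m → Euc n × Ξ → Euc n) (L : Fin m → Euc n × Ξ → ℝ) (v : Fin m → Euc n → ℝ)
    (i : Fin m) (G : Euc n → Euc n) (q : Euc n × ℝ) : ℝ :=
  lam * q.2 + (∑ j, B q.1 i j * (if j = i then q.2 else v j q.1)) + ham g L i q.1 (G q.1)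

section
variable {n m : ℕ} {Ξ : Type*} [MetricSpace Ξ] [CompactSpace Ξ]
    {g : Fin m → Euc n × Ξ → Euc n} {L : Fin m → Euc n × Ξ → ℝ}
    {B : Euc n → Matrix (Fin m) (Fin m) ℝ} {lam : ℝ} {v : Fin m → Euc n → ℝ}

theorem opF_cont (hgL : GoodData g L) (hB : GoodCoupling B) (hv : ∀ i, Continuous (v i))
    (i : Fin m) {G : Euc n → Euc n} (hG : Continuous G) : Continuous (opF B lam g L v i G) := by
  unfold opF
  refine ((continuous_const.mul continuous_snd).add
    (continuous_finsetSum _ fun j _ => ((hB.1 i j).1.comp continuous_fst).mul ?_)).add ?_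
  · split_ifs
    · exact continuous_snd
    · exact (hv j).comp continuous_fst
  · exact Continuous.comp (g := fun q : Euc n × Euc n => ham g L i q.1 q.2)
      (f := fun q : Euc n × ℝ => (q.1, G q.1)) (continuous_ham hgL i)
      (continuous_fst.prodMk (hG.comp continuous_fst))

theorem opF_self (i : Fin m) (G : Euc n → Euc n) (x : Euc n) :
    opF B lam g L v i G (x, v i x) =
      lam * v i x + (∑ j, B x i j * v j x) + ham g L i x (G x) := by
  unfold opF
  congr 2
  refine Finset.sum_congr rfl fun j _ => ?_
  by_cases h : j = i
  · subst h; simp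
  · simp [h]

theorem opF_per (hgL : GoodData g L) (hB : GoodCoupling B) (hv : ∀ i, TorusFun (v i))
    (i : Fin m) {G : Euc n → Euc n} (hG : TorusFun G) (x z : Euc n) (s : ℝ) (hz : IsIntVec z) :
    opF B lam g L v i G (x + z, s) = opF B lam g L v i G (x, s) := by
  have hb : ∀ j, B (x + z) i j = B x i j := fun j => (hB.1 i j).2 x z hz
  unfold opF
  simp only [ham_periodic hgL i x z _ hz, hG x z hz, hv _ x z hz, hb]

theorem stability (hgL : GoodData g L) (hB : GoodCoupling B) (hlam : 0 < lam)
    (S : Set (Fin m → Euc n → ℝ))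
    (hS : ∀ u ∈ S, (∀ i, Continuous (u i)) ∧ IsSubsol B lam g L (fun _ => 0) u)
    (hv : ∀ i, Continuous (v i)) (hvp : ∀ i, TorusFun (v i))
    (hle : ∀ u ∈ S, ∀ i x, u i x ≤ v i x)
    (happ : ∀ i x η, 0 < η → ∃ u ∈ S, v i x - η < u i x) :
    IsSubsol B lam g L (fun _ => 0) v := by
  refine ⟨fun i => ⟨(hv i).upperSemicontinuous, hvp i⟩, fun i ψ hψ hψp x hx => ?_⟩
  obtain ⟨φ, hφ, hφp, hφx, hφg, hφS⟩ := globalize (hv i) (hvp i) hψ hψp hx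
  by_contra hlt
  push Not at hlt
  rw [← hφg, ← opF_self i (gradient φ) x] at hlt
  have hcont := opF_cont (lam := lam) hgL hB hv i (grad_continuous hφ)
  obtain ⟨δ, hδ, hball⟩ := Metric.eventually_nhds_iff.1
    (hcont.continuousAt.eventually_const_lt hlt)
  obtain ⟨δ', hδ', hball'⟩ := Metric.continuousAt_iff.1 (hφ.continuous.continuousAt (x := x))
    (δ/2) (by positivity)
  set r := min δ δ' with hr
  have hr0 : 0 < r := lt_min hδ hδ'
  set η := min (δ/2) (r^2) with hη
  have hη0 : 0 < η := by positivity
  obtain ⟨u, huS, hu⟩ := happ i x η hη0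
  obtain ⟨huc, hus⟩ := hS u huS
  obtain ⟨y', hy'⟩ := TorusFun.exists_max (f := fun y => u i y - φ y)
    ((huc i).sub hφ.continuous)
    (fun x z hz => by simp only [(hus.1 i).2 x z hz, hφp x z hz])
  have h1 := hy' x
  obtain ⟨z, hz, h4⟩ := perS_ge (y' - x)
  have h2 := hle u huS i y'
  have h3 := hφS y'
  have hnorm : ‖y' - x - z‖ < r := by
    have : ‖y' - x - z‖^2 < r^2 := by
      have := min_le_right (δ/2) (r^2)
      nlinarith [sq_nonneg ‖y' - x - z‖]
    exact lt_of_pow_lt_pow_left₀ 2 hr0.le this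
  set y := y' + -z with hy
  have eu : u i y = u i y' := (hus.1 i).2 _ _ hz.neg'
  have eφ : φ y = φ y' := hφp _ _ hz.neg'
  have hyx : dist y x < r := by
    rw [dist_eq_norm, hy, show y' + -z - x = y' - x - z by abel]; exact hnorm
  have hsub := hus.2 i φ hφ hφp y (Filter.Eventually.of_forall fun w => by
    simp only; rw [eu, eφ]; exact hy' w)
  have h5 : φ y - η ≤ u i y := by linarith
  have h6 : opF B lam g L v i (gradient φ) (y, φ y - η) ≤
      lam * u i y + ∑ j, B y i j * u j y + ham g L i y (gradient φ y) := by
    unfold opF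
    simp only
    refine add_le_add (add_le_add (mul_le_mul_of_nonneg_left h5 hlam.le)
      (Finset.sum_le_sum fun j _ => ?_)) le_rfl
    by_cases h : j = i
    · subst h
      simp only [if_true]
      exact mul_le_mul_of_nonneg_left h5 (mono_diag (hB.2 y) j)
    · simp only [h, if_false]
      exact mul_le_mul_of_nonpos_left (hle u huS j y) (mono_off (hB.2 y) h)
  have h7 := hball (y := (y, φ y - η)) (by
    rw [Prod.dist_eq]
    refine max_lt (lt_of_lt_of_le hyx (min_le_left _ _)) ?_
    have h8 := hball' (lt_of_lt_of_le hyx (min_le_right _ _))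
    simp only
    rw [Real.dist_eq] at h8 ⊢
    rw [hφx] at h8
    have h9 := abs_lt.1 h8
    have := min_le_left (δ/2) (r^2)
    rw [abs_lt]
    constructor <;> linarith [h9.1, h9.2])
  linarith

theorem grad_neg' {f : Euc n → ℝ} (x : Euc n) : gradient (fun y => - f y) x = - gradient f x := by
  unfold gradient
  rw [fderiv_fun_neg, map_neg]

theorem perron_super (hgL : GoodData g L) (hB : GoodCoupling B)
    (hv : ∀ i, Continuous (v i)) (hsub : IsSubsol B lam g L (fun _ => 0) v)
    (hmaxl : ∀ w : Fin m → Euc n → ℝ, (∀ i, Continuous (w i)) → IsSubsol B lam g L (fun _ => 0) w →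
      (∀ i x, v i x ≤ w i x) → ∀ i x, w i x ≤ v i x) :
    IsSupersol B lam g L (fun _ => 0) v := by
  have hvp := fun i => (hsub.1 i).2
  refine ⟨fun i => ⟨(hv i).lowerSemicontinuous, hvp i⟩, fun i ψ hψ hψp x hx => ?_⟩
  obtain ⟨φ', hφ', hφp', hφx', hφg', hφS'⟩ := globalize (f := fun y => - v i y)
    (ψ := fun y => - ψ y) (x := x) (hv i).neg
    (fun x z hz => by simp only [hvp i x z hz]) hψ.neg
    (fun x z hz => by simp only [hψp x z hz]) (by
      filter_upwards [hx] with y hy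
      linarith)
  obtain ⟨φ, hφdef⟩ : ∃ φ : Euc n → ℝ, φ = fun y => - φ' y := ⟨_, rfl⟩
  have hφ : ContDiff ℝ 1 φ := by rw [hφdef]; exact hφ'.neg
  have hφp : TorusFun φ := fun x z hz => by simp only [hφdef, hφp' x z hz]
  have hφx : φ x = v i x := by simp [hφdef, hφx']
  have hφg : gradient φ x = gradient ψ x := by
    rw [hφdef, grad_neg', hφg', grad_neg', neg_neg]
  have hφS : ∀ y, φ y + perS (y - x) ≤ v i y := fun y => by
    have := hφS' y
    simp only [hφdef]
    linarith
  by_contra hlt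
  push Not at hlt
  rw [← hφg, ← opF_self i (gradient φ) x] at hlt
  have hcont := opF_cont (lam := lam) hgL hB hv i (grad_continuous hφ)
  obtain ⟨δ, hδ, hball⟩ := Metric.eventually_nhds_iff.1
    (hcont.continuousAt.eventually_lt_const hlt)
  obtain ⟨δ', hδ', hball'⟩ := Metric.continuousAt_iff.1 (hφ.continuous.continuousAt (x := x))
    (δ/2) (by positivity)
  set r := min δ δ' with hr
  have hr0 : 0 < r := lt_min hδ hδ'
  set ε := min (δ/4) (r^2) with hε
  have hε0 : 0 < ε := by positivity
  let w : Fin m → Euc n → ℝ := fun j y => if j = i then max (v i y) (φ y + ε) else v j y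
  have hwi : ∀ y, w i y = max (v i y) (φ y + ε) := fun y => by simp [w]
  have hwj : ∀ j, j ≠ i → ∀ y, w j y = v j y := fun j hj y => by simp [w, hj]
  have hge : ∀ j y, v j y ≤ w j y := fun j y => by
    by_cases h : j = i
    · subst h; rw [hwi]; exact le_max_left _ _
    · rw [hwj j h]
  have hwc : ∀ j, Continuous (w j) := fun j => by
    by_cases h : j = i
    · subst h
      rw [show w j = _ from funext hwi]
      exact (hv j).max (hφ.continuous.add continuous_const)
    · rw [show w j = v j from funext (hwj j h)]; exact hv j
  have hwp : ∀ j, TorusFun (w j) := fun j y z hz => by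
    simp only [w, hvp _ y z hz, hφp y z hz]
  have hws : IsSubsol B lam g L (fun _ => 0) w := by
    refine ⟨fun j => ⟨(hwc j).upperSemicontinuous, hwp j⟩, fun k χ hχ hχp y hy => ?_⟩
    by_cases hcase : w k y = v k y
    · have h1 := hsub.2 k χ hχ hχp y (by
        filter_upwards [hy] with t ht
        have := hge k t
        linarith)
      have h2 : ∑ j, B y k j * w j y ≤ ∑ j, B y k j * v j y := by
        refine Finset.sum_le_sum fun j _ => ?_
        by_cases hj : j = k
        · rw [hj, hcase]
        · exact mul_le_mul_of_nonpos_left (hge j y) (mono_off (hB.2 y) hj)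
      rw [hcase]
      linarith
    · have hki : k = i := by
        by_contra h
        exact hcase (hwj k h y)
      subst hki
      have hlt2 : v k y < φ y + ε := by
        by_contra h
        push Not at h
        exact hcase (by rw [hwi, max_eq_left h])
      have hwy : w k y = φ y + ε := by rw [hwi, max_eq_right hlt2.le]
      have hgr : gradient χ y = gradient φ y := by
        have hloc : IsLocalMax (fun t => φ t - χ t) y := by
          filter_upwards [hy] with t ht
          rw [hwy, hwi t] at ht
          have := le_max_right (v k t) (φ t + ε)
          linarith
        have h0 := hloc.fderiv_eq_zero
        rw [fderiv_fun_sub (hφ.differentiable (by norm_num) y)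
          (hχ.differentiable (by norm_num) y), sub_eq_zero] at h0
        unfold gradient
        rw [h0]
      obtain ⟨z, hz, h4⟩ := perS_ge (y - x)
      have h3 := hφS y
      have hnorm : ‖y - x - z‖ < r := by
        have : ‖y - x - z‖^2 < r^2 := by
          have := min_le_right (δ/4) (r^2)
          nlinarith [sq_nonneg ‖y - x - z‖]
        exact lt_of_pow_lt_pow_left₀ 2 hr0.le this
      have hyx : dist (y + -z) x < r := by
        rw [dist_eq_norm, show y + -z - x = y - x - z by abel]; exact hnorm
      have h7 := hball (y := (y + -z, φ (y + -z) + ε)) (by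
        rw [Prod.dist_eq]
        refine max_lt (lt_of_lt_of_le hyx (min_le_left _ _)) ?_
        have h8 := hball' (lt_of_lt_of_le hyx (min_le_right _ _))
        simp only
        rw [Real.dist_eq] at h8 ⊢
        rw [hφx] at h8
        have h9 := abs_lt.1 h8
        have := min_le_left (δ/4) (r^2)
        rw [abs_lt]
        constructor <;> linarith [h9.1, h9.2])
      rw [hφp _ _ hz.neg', opF_per hgL hB hvp k (grad_periodic hφp) _ _ _ hz.neg'] at h7
      rw [hgr, hwy]
      have e : ∑ j, B y k j * w j y = ∑ j, B y k j * (if j = k then φ y + ε else v j y) := by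
        refine Finset.sum_congr rfl fun j _ => ?_
        by_cases hj : j = k
        · subst hj; rw [hwy]; simp
        · rw [hwj j hj]; simp [hj]
      rw [e]
      exact h7.le
  have := hmaxl w hwc hws hge i x
  rw [hwi, hφx] at this
  have := (le_max_right _ _).trans this
  linarith

end

end helpers

theorem stmt4 {n m : ℕ} (hn : 0 < n) (hm : 0 < m)
    {Ξ : Type*} [MetricSpace Ξ] [CompactSpace Ξ] [Nonempty Ξ]
    (g : Fin m → Euc n × Ξ → Euc n) (L : Fin m → Euc n × Ξ → ℝ)
    (hgL : GoodData g L) (hcoer : Coercive g L)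
    (B : Euc n → Matrix (Fin m) (Fin m) ℝ) (hB : GoodCoupling B)
    (lam : ℝ) (hlam : 0 < lam) :
    ∃ v : Fin m → Euc n → ℝ, IsSol B lam g L (fun _ => 0) v ∧
      (∀ i, ∃ K : NNReal, LipschitzWith K (v i)) ∧
      ∀ w : Fin m → Euc n → ℝ, IsSol B lam g L (fun _ => 0) w → w = v := by
  
  -- bounds for constants
  obtain ⟨H0, hH00, hH0⟩ : ∃ H0, 0 ≤ H0 ∧ ∀ i x, |ham g L i x 0| ≤ H0 := by
    have := fun i : Fin m => TorusFun.bdd (f := fun x => ham g L i x 0)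
      (Continuous.comp (g := fun q : Euc n × Euc n => ham g L i q.1 q.2)
        (f := fun x : Euc n => (x, (0 : Euc n))) (continuous_ham hgL i) (by fun_prop))
      (fun x z hz => ham_periodic hgL i x z 0 hz)
    choose b hb0 hb using this
    refine ⟨∑ q, b q, Finset.sum_nonneg fun q _ => hb0 q, fun i x => (hb i x).trans ?_⟩
    exact Finset.single_le_sum (f := b) (fun q _ => hb0 q) (Finset.mem_univ i)
  set C := H0 / lam with hCdef
  have hC0 : 0 ≤ C := by positivity
  have hlC : lam * C = H0 := by rw [hCdef]; field_simp
  have hne : Nonempty (Fin m) := ⟨⟨0, hm⟩⟩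
  have hg0 : ∀ (a : ℝ) (x : Euc n), gradient (fun _ : Euc n => a) x = 0 := fun a x => by
    simp [gradient]
  -- upper bound of subsolutions
  have hupper : ∀ u : Fin m → Euc n → ℝ, (∀ i, Continuous (u i)) →
      IsSubsol B lam g L (fun _ => 0) u → ∀ i x, u i x ≤ C := by
    intro u huc hu i x
    choose q hq using fun i => TorusFun.exists_max (huc i) (hu.1 i).2
    obtain ⟨k, hk⟩ := Finite.exists_max (fun i => u i (q i))
    refine ((hq i x).trans (hk i)).trans ?_
    by_cases hneg : u k (q k) < 0
    · linarith
    push Not at hneg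
    have h1 := hu.2 k (fun _ => 0) contDiff_const (fun _ _ _ => rfl) (q k)
      (Filter.Eventually.of_forall fun y => by simpa using hq k y)
    rw [hg0] at h1
    have h2 := hB.2 (q k) (fun j => u j (q k)) k (fun j => (hq j _).trans (hk j)) hneg
    have h3 := (abs_le.1 (hH0 k (q k))).1
    rw [hCdef, le_div_iff₀ hlam]
    linarith
  obtain ⟨R, hR0, hR⟩ := grad_bound hcoer hB lam C hC0
  -- Perron family
  let S : Set (Fin m → Euc n → ℝ) := {u | (∀ i, Continuous (u i)) ∧
    IsSubsol B lam g L (fun _ => 0) u ∧ ∀ i x, -C ≤ u i x}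
  have hSub : ∀ u ∈ S, ∀ i x, u i x ≤ C := fun u hu => hupper u hu.1 hu.2.1
  have hSabs : ∀ u ∈ S, ∀ i x, |u i x| ≤ C := fun u hu i x =>
    abs_le.2 ⟨hu.2.2 i x, hSub u hu i x⟩
  set K : NNReal := Real.toNNReal (R + 1) with hKdef
  have hSLip : ∀ u ∈ S, ∀ i, LipschitzWith K (u i) := fun u hu i =>
    sub_lipschitz hu.1 hu.2.1 C R hR0 (hSabs u hu) hR i
  have hconst : (fun _ _ => -C) ∈ S := by
    refine ⟨fun i => continuous_const, ⟨fun i => ⟨continuous_const.upperSemicontinuous,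
      fun _ _ _ => rfl⟩, fun i ψ hψ hψp x hx => ?_⟩, fun i x => le_rfl⟩
    have hg : gradient ψ x = 0 := by
      have h0 := hx.fderiv_eq_zero
      rw [fderiv_const_sub, neg_eq_zero] at h0
      simp [gradient, h0]
    rw [hg]
    have h1 := (abs_le.1 (hH0 i x)).2
    have h2 := mono_row (hB.2 x) i
    rw [← Finset.sum_mul]
    nlinarith
  have hSne : Nonempty S := ⟨⟨_, hconst⟩⟩
  let v : Fin m → Euc n → ℝ := fun i x => ⨆ u : S, u.1 i x
  have hbdd : ∀ i x, BddAbove (Set.range fun u : S => u.1 i x) := fun i x =>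
    ⟨C, by rintro _ ⟨u, rfl⟩; exact hSub u.1 u.2 i x⟩
  have hle : ∀ u ∈ S, ∀ i x, u i x ≤ v i x := fun u hu i x => le_ciSup (hbdd i x) ⟨u, hu⟩
  have happ : ∀ i x η, 0 < η → ∃ u ∈ S, v i x - η < u i x := fun i x η hη => by
    obtain ⟨u, hu⟩ := exists_lt_of_lt_ciSup (show v i x - η < ⨆ u : S, u.1 i x by
      change v i x - η < v i x
      linarith)
    exact ⟨u.1, u.2, hu⟩
  have hvLip : ∀ i, LipschitzWith K (v i) := fun i => by
    apply LipschitzWith.of_le_add_mul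
    intro x y
    refine ciSup_le fun u => ?_
    have h1 := LipschitzWith.le_add_mul (hSLip u.1 u.2 i) x y
    have h2 := hle u.1 u.2 i y
    linarith
  have hvc : ∀ i, Continuous (v i) := fun i => (hvLip i).continuous
  have hvp : ∀ i, TorusFun (v i) := fun i x z hz => by
    have : ∀ u : S, u.1 i (x + z) = u.1 i x := fun u => (u.2.2.1.1 i).2 x z hz
    simp only [v, this]
  have hvsub : IsSubsol B lam g L (fun _ => 0) v :=
    stability hgL hB hlam S (fun u hu => ⟨hu.1, hu.2.1⟩) hvc hvp hle happ
  have hvge : ∀ i x, -C ≤ v i x := fun i x => hle _ hconst i x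
  have hvsup : IsSupersol B lam g L (fun _ => 0) v :=
    perron_super hgL hB hvc hvsub (fun w hwc hws hwge i x =>
      hle w ⟨hwc, hws, fun j y => (hvge j y).trans (hwge j y)⟩ i x)
  have hvS : v ∈ S := ⟨hvc, hvsub, hvge⟩
  refine ⟨v, ⟨hvc, hvsub, hvsup⟩, fun i => ⟨K, hvLip i⟩, fun w hw => ?_⟩
  obtain ⟨hwc, hwsub, hwsup⟩ := hw
  have h1 : ∀ i x, v i x ≤ w i x :=
    comparison hgL hB hlam hvc hwc hvsub hwsup K hvLip C R (hSabs v hvS) hR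
  have hwS : w ∈ S := ⟨hwc, hwsub, fun i x => (hvge i x).trans (h1 i x)⟩
  funext i x
  exact le_antisymm (hle w hwS i x) (h1 i x)
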